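/- With the discharging setup below and d ∈ {3,4}, for each x ∈ X₃^- = {x ∈ X : d ≤ d(x) < 3(d−1)} one has M₂*(x) ≥ (d+2)Δ = M₂(x). -/

import Mathlib

open Finset

variable {V : Type*}

/-- `φ` is a proper edge coloring of `G` with colors in `{1, …, k}`, encoded as a symmetric
function on ordered pairs of vertices: every edge receives a color in `[1,k]` and two distinct
edges sharing a vertex receive different colors. -/
def IsEdgeColoring (G : SimpleGraph V) (k : ℕ) (φ : V → V → ℕ) : Prop :=
  (∀ u v, φ u v = φ v u) ∧
  (∀ ⦃u v⦄, G.Adj u v → φ u v ∈ Finset.Icc 1 k) ∧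
  (∀ ⦃v a b⦄, G.Adj v a → G.Adj v b → a ≠ b → φ v a ≠ φ v b)

/-- The chromatic index of `G`: the least `k` such that `G` has a proper edge `k`-coloring. -/
noncomputable def chromIndex (G : SimpleGraph V) : ℕ :=
  sInf {k | ∃ φ : V → V → ℕ, IsEdgeColoring G k φ}

/-- `G` is `Δ`-critical: `G` is connected, `χ'(G) = Δ + 1`, and `χ'(G - e) = Δ` for every
edge `e` of `G`, where `Δ` is the maximum degree of `G`. -/
def IsDeltaCritical [Fintype V] (G : SimpleGraph V) [DecidableRel G.Adj] : Prop :=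
  G.Connected ∧ chromIndex G = G.maxDegree + 1 ∧
    ∀ e ∈ G.edgeSet, chromIndex (G.deleteEdges {e}) = G.maxDegree

/-- The independence number of `G`. -/
noncomputable def indepNum [Fintype V] (G : SimpleGraph V) : ℕ :=
  sSup {n | ∃ s : Finset V, (∀ u ∈ s, ∀ v ∈ s, u ≠ v → ¬ G.Adj u v) ∧ s.card = n}

noncomputable section

open scoped Classical

variable [Fintype V]

/-- `g₁(k) = (d+2)(Δ-k)/k`. -/
def g1 (d : ℕ) (Δ k : ℝ) : ℝ := ((d : ℝ) + 2) * (Δ - k) / k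

/-- The set `X⁺ = {x ∈ X : q ≤ d(x) < Δ}`. -/
def Xp (G : SimpleGraph V) [DecidableRel G.Adj] (q : ℝ) (X : Finset V) : Finset V :=
  X.filter fun x => q ≤ (G.degree x : ℝ) ∧ G.degree x < G.maxDegree

/-- The set `X⁻ = {x ∈ X : d ≤ d(x) < q}`. -/
def Xm (G : SimpleGraph V) [DecidableRel G.Adj] (d : ℕ) (q : ℝ) (X : Finset V) : Finset V :=
  X.filter fun x => d ≤ G.degree x ∧ (G.degree x : ℝ) < q

/-- The charge `M₁*(y)` of a vertex `y ∈ Y` after Step 1 of the discharging rule: starting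
from `M₁(y) = ωΔ`, the vertex `y` gives charge `g₁(d(x))` to each `x ∈ N(y) ∩ X⁺`. -/
def M1star (G : SimpleGraph V) [DecidableRel G.Adj] (d : ℕ) (ω q : ℝ) (X : Finset V)
    (y : V) : ℝ :=
  ω * G.maxDegree -
    ∑ x ∈ G.neighborFinset y ∩ Xp G q X, g1 d (G.maxDegree : ℝ) (G.degree x : ℝ)

/-- The charge that `y ∈ Y` gives to each vertex of `N(y) ∩ X⁻` in Step 2 of the discharging
rule: if `M₁*(y) > 0`, then `y` distributes its remaining charge equally among all vertices
(if any) of `N(y) ∩ X⁻`. -/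
def step2 (G : SimpleGraph V) [DecidableRel G.Adj] (d : ℕ) (ω q : ℝ) (X : Finset V)
    (y : V) : ℝ :=
  if 0 < M1star G d ω q X y ∧ (G.neighborFinset y ∩ Xm G d q X).Nonempty then
    M1star G d ω q X y / ((G.neighborFinset y ∩ Xm G d q X).card : ℝ)
  else 0

/-- The final charge `M₂*(y)` of a vertex `y ∈ Y`. -/
def M2starY (G : SimpleGraph V) [DecidableRel G.Adj] (d : ℕ) (ω q : ℝ) (X : Finset V)
    (y : V) : ℝ :=
  M1star G d ω q X y - ((G.neighborFinset y ∩ Xm G d q X).card : ℝ) * step2 G d ω q X y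

/-- The final charge `M₂*(x)` of a vertex `x ∈ X`: starting from `M₁(x) = (d+2)d(x)`,
`x` receives `g₁(d(x))` from each neighbor `y ∈ Y` in Step 1 if `x ∈ X⁺`, and receives the
Step-2 charge from each neighbor `y ∈ Y` if `x ∈ X⁻`. -/
def M2starX (G : SimpleGraph V) [DecidableRel G.Adj] (d : ℕ) (ω q : ℝ) (X : Finset V)
    (x : V) : ℝ :=
  ((d : ℝ) + 2) * G.degree x +
    (if x ∈ Xp G q X then
      ∑ y ∈ (G.neighborFinset x).filter (· ∉ X), g1 d (G.maxDegree : ℝ) (G.degree x : ℝ)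
    else 0) +
    (if x ∈ Xm G d q X then
      ∑ y ∈ (G.neighborFinset x).filter (· ∉ X), step2 G d ω q X y
    else 0)

/-- `σ_q(x,z) = |{u ∈ N(z) - {x} : d(u) ≥ q}|`. -/
def sigmaq (G : SimpleGraph V) [DecidableRel G.Adj] (q : ℝ) (x z : V) : ℕ :=
  ((G.neighborFinset z).filter fun u => u ≠ x ∧ q ≤ (G.degree u : ℝ)).card

end

variable [Fintype V]

/-! ### Kempe changes on colorings with one edge coloured `0` -/

set_option linter.unusedSectionVars false
set_option linter.unusedVariables false

section Kempe

open scoped Classical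

/-- Fixed data: `G`, the centre `x`, number of colors `D`, and a set of low vertices. -/
structure Ctx (G : SimpleGraph V) [DecidableRel G.Adj] (x : V) (D : ℕ) (Low : V → Prop) : Prop where
  hno : ∀ φ, ¬ IsEdgeColoring G D φ
  hdeg : ∀ v, G.degree v ≤ D
  lowx : ∀ z, Low z → ¬ G.Adj x z ∧ z ≠ x
  lowdeg : ∀ z, Low z → G.degree z + G.degree x + 2 ≤ D

/-- proper coloring of `G` with colors `0..D`, colour `0` being used on the edge `xv` only. -/
structure Col (G : SimpleGraph V) (x : V) (D : ℕ) (v : V) (φ : V → V → ℕ) : Prop where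
  adj : G.Adj x v
  sym : ∀ a b, φ a b = φ b a
  le : ∀ a b, G.Adj a b → φ a b ≤ D
  proper : ∀ p a b, G.Adj p a → G.Adj p b → φ p a = φ p b → a = b
  zero : ∀ a b, G.Adj a b → (φ a b = 0 ↔ (a = x ∧ b = v) ∨ (a = v ∧ b = x))

/-- colour `c` is missing at `p`. -/
def Miss (G : SimpleGraph V) (D : ℕ) (φ : V → V → ℕ) (p : V) (c : ℕ) : Prop :=
  1 ≤ c ∧ c ≤ D ∧ ∀ b, G.Adj p b → φ p b ≠ c

/-- colour `c` is missing at `p`, or used on an edge from `p` to a low vertex. -/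
def MM (G : SimpleGraph V) (D : ℕ) (Low : V → Prop) (φ : V → V → ℕ) (p : V) (c : ℕ) : Prop :=
  Miss G D φ p c ∨ ∃ z, G.Adj p z ∧ Low z ∧ φ p z = c

/-- swap two colors on the vertex set `K`. -/
noncomputable def sw (α β : ℕ) (K : Set V) (φ : V → V → ℕ) : V → V → ℕ := fun a b =>
  if a ∈ K ∧ b ∈ K then Equiv.swap α β (φ a b) else φ a b

/-- `K` is closed along edges coloured `α` or `β`. -/
def Clo (G : SimpleGraph V) (φ : V → V → ℕ) (α β : ℕ) (K : Set V) : Prop :=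
  ∀ a b, G.Adj a b → a ∈ K → (φ a b = α ∨ φ a b = β) → b ∈ K

/-- the two-coloured graph. -/
def HH (G : SimpleGraph V) (φ : V → V → ℕ) (hs : ∀ a b, φ a b = φ b a) (α β : ℕ) : SimpleGraph V where
  Adj a b := G.Adj a b ∧ (φ a b = α ∨ φ a b = β)
  symm := ⟨fun a b h => ⟨h.1.symm, by rw [hs b a]; exact h.2⟩⟩
  loopless := ⟨fun a h => G.loopless.irrefl a h.1⟩

/-- Kempe component -/
def KK (G : SimpleGraph V) (φ : V → V → ℕ) (hs : ∀ a b, φ a b = φ b a) (α β : ℕ) (p : V) : Set V :=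
  {a | (HH G φ hs α β).Reachable p a}

theorem KK_clo {G : SimpleGraph V} {φ : V → V → ℕ} (hs : ∀ a b, φ a b = φ b a) (α β : ℕ) (p : V) :
    Clo G φ α β (KK G φ hs α β p) := by
  intro a b hab ha hc
  exact SimpleGraph.Reachable.trans ha (SimpleGraph.Adj.reachable (G := HH G φ hs α β) ⟨hab, hc⟩)

theorem KK_self {G : SimpleGraph V} {φ : V → V → ℕ} (hs : ∀ a b, φ a b = φ b a) (α β : ℕ) (p : V) :
    p ∈ KK G φ hs α β p := SimpleGraph.Reachable.refl _

theorem sw_edge {G : SimpleGraph V} {φ : V → V → ℕ} {α β : ℕ} {K : Set V}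
    (hK : Clo G φ α β K) {a b : V} (hab : G.Adj a b) :
    sw α β K φ a b = if a ∈ K then Equiv.swap α β (φ a b) else φ a b := by
  unfold sw
  by_cases ha : a ∈ K
  · by_cases hb : b ∈ K
    · simp [ha, hb]
    · have : ¬ (φ a b = α ∨ φ a b = β) := fun h => hb (hK a b hab ha h)
      push Not at this
      simp [ha, hb, Equiv.swap_apply_of_ne_of_ne this.1 this.2]
  · simp [ha]

theorem sw_other {G : SimpleGraph V} {φ : V → V → ℕ} {α β : ℕ} {K : Set V}
    (hK : Clo G φ α β K) {a b : V} (hab : G.Adj a b) {c : ℕ} (h1 : c ≠ α) (h2 : c ≠ β) :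
    sw α β K φ a b = c ↔ φ a b = c := by
  rw [sw_edge hK hab]
  split_ifs with h
  · rw [Equiv.swap_apply_eq_iff, Equiv.swap_apply_of_ne_of_ne h1 h2]
  · rfl

theorem sw_sym {φ : V → V → ℕ} {α β : ℕ} {K : Set V} (hs : ∀ a b, φ a b = φ b a) (a b : V) :
    sw α β K φ a b = sw α β K φ b a := by
  unfold sw
  rw [hs a b]
  simp only [and_comm]

theorem sw_le {G : SimpleGraph V} {φ : V → V → ℕ} {α β D : ℕ} {K : Set V}
    (hl : ∀ a b, G.Adj a b → φ a b ≤ D) (hα : α ≤ D) (hβ : β ≤ D) (a b : V) (h : G.Adj a b) :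
    sw α β K φ a b ≤ D := by
  unfold sw
  split_ifs
  · rw [Equiv.swap_apply_def]
    split_ifs
    · exact hβ
    · exact hα
    · exact hl a b h
  · exact hl a b h

theorem sw_proper {G : SimpleGraph V} {φ : V → V → ℕ} {α β : ℕ} {K : Set V}
    (hK : Clo G φ α β K)
    (hp : ∀ p a b, G.Adj p a → G.Adj p b → φ p a = φ p b → a = b)
    (p a b : V) (h1 : G.Adj p a) (h2 : G.Adj p b) (h : sw α β K φ p a = sw α β K φ p b) : a = b := by
  rw [sw_edge hK h1, sw_edge hK h2] at h
  split_ifs at h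
  · exact hp p a b h1 h2 ((Equiv.swap α β).injective h)
  · exact hp p a b h1 h2 h

theorem Col.sw {G : SimpleGraph V} {x : V} {D : ℕ} {v : V} {φ : V → V → ℕ} (h : Col G x D v φ)
    {α β : ℕ} {K : Set V} (hK : Clo G φ α β K) (hα : 1 ≤ α) (hα' : α ≤ D) (hβ : 1 ≤ β) (hβ' : β ≤ D) :
    Col G x D v (sw α β K φ) where
  adj := h.adj
  sym := sw_sym h.sym
  le := sw_le h.le hα' hβ'
  proper := sw_proper hK h.proper
  zero a b hab := by rw [sw_other hK hab (by omega) (by omega)]; exact h.zero a b hab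

theorem miss_sw_other {G : SimpleGraph V} {φ : V → V → ℕ} {D α β : ℕ} {K : Set V}
    (hK : Clo G φ α β K) {p : V} {c : ℕ} (h1 : c ≠ α) (h2 : c ≠ β) :
    Miss G D (sw α β K φ) p c ↔ Miss G D φ p c := by
  unfold Miss
  refine and_congr_right fun _ => and_congr_right fun _ => forall_congr' fun b => forall_congr' fun hb => ?_
  rw [Ne, Ne, sw_other hK hb h1 h2]

theorem miss_sw_notin {G : SimpleGraph V} {φ : V → V → ℕ} {D α β : ℕ} {K : Set V}
    {p : V} (hp : p ∉ K) {c : ℕ} :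
    Miss G D (sw α β K φ) p c ↔ Miss G D φ p c := by
  unfold Miss sw
  simp [hp]

theorem miss_sw_left {G : SimpleGraph V} {φ : V → V → ℕ} {D α β : ℕ} {K : Set V}
    (hK : Clo G φ α β K) {p : V} (hp : p ∈ K) (hα : 1 ≤ α) (hα' : α ≤ D) (h : Miss G D φ p β) :
    Miss G D (sw α β K φ) p α := by
  refine ⟨hα, hα', fun b hb => ?_⟩
  rw [sw_edge hK hb, if_pos hp, Ne, Equiv.swap_apply_eq_iff, Equiv.swap_apply_left]
  exact h.2.2 b hb

theorem miss_sw_right {G : SimpleGraph V} {φ : V → V → ℕ} {D α β : ℕ} {K : Set V}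
    (hK : Clo G φ α β K) {p : V} (hp : p ∈ K) (hβ : 1 ≤ β) (hβ' : β ≤ D) (h : Miss G D φ p α) :
    Miss G D (sw α β K φ) p β := by
  refine ⟨hβ, hβ', fun b hb => ?_⟩
  rw [sw_edge hK hb, if_pos hp, Ne, Equiv.swap_apply_eq_iff, Equiv.swap_apply_right]
  exact h.2.2 b hb

theorem MM_sw_other {G : SimpleGraph V} {φ : V → V → ℕ} {D α β : ℕ} {Low : V → Prop} {K : Set V}
    (hK : Clo G φ α β K) {p : V} {c : ℕ} (h1 : c ≠ α) (h2 : c ≠ β) :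
    MM G D Low (sw α β K φ) p c ↔ MM G D Low φ p c := by
  unfold MM
  rw [miss_sw_other hK h1 h2]
  refine or_congr Iff.rfl (exists_congr fun z => and_congr_right fun hz => ?_)
  rw [sw_other hK hz h1 h2]

theorem MM_sw_notin {G : SimpleGraph V} {φ : V → V → ℕ} {D α β : ℕ} {Low : V → Prop} {K : Set V}
    {p : V} (hp : p ∉ K) {c : ℕ} :
    MM G D Low (sw α β K φ) p c ↔ MM G D Low φ p c := by
  unfold MM
  rw [miss_sw_notin hp]
  simp [sw, hp]

/-- Three distinct end vertices cannot lie in one Kempe component. -/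
theorem three_ends {G : SimpleGraph V} {φ : V → V → ℕ} (hs : ∀ a b, φ a b = φ b a)
    (hp : ∀ p a b, G.Adj p a → G.Adj p b → φ p a = φ p b → a = b) {α β : ℕ} {p₁ p₂ p₃ : V}
    (h12 : p₁ ≠ p₂) (h13 : p₁ ≠ p₃) (h23 : p₂ ≠ p₃)
    (e₁ : (∀ b, G.Adj p₁ b → φ p₁ b ≠ α) ∨ (∀ b, G.Adj p₁ b → φ p₁ b ≠ β))
    (e₂ : (∀ b, G.Adj p₂ b → φ p₂ b ≠ α) ∨ (∀ b, G.Adj p₂ b → φ p₂ b ≠ β))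
    (e₃ : (∀ b, G.Adj p₃ b → φ p₃ b ≠ α) ∨ (∀ b, G.Adj p₃ b → φ p₃ b ≠ β))
    (k₂ : p₂ ∈ KK G φ hs α β p₁) (k₃ : p₃ ∈ KK G φ hs α β p₁) : False := by
  set H := HH G φ hs α β with hH
  set C := H.connectedComponentMk p₁ with hC
  have hconn := C.connected_toSimpleGraph
  have m1 : p₁ ∈ C := rfl
  have m2 : p₂ ∈ C := SimpleGraph.ConnectedComponent.sound (SimpleGraph.Reachable.symm k₂)
  have m3 : p₃ ∈ C := SimpleGraph.ConnectedComponent.sound (SimpleGraph.Reachable.symm k₃)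
  have hcard := hconn.card_vert_le_card_edgeSet_add_one
  have hsum := C.toSimpleGraph.sum_degrees_eq_twice_card_edges
  have key : ∀ (p : C), ∀ S : Finset ℕ, (∀ b, H.Adj p b → φ p b ∈ S) → C.toSimpleGraph.degree p ≤ S.card := by
    intro p S hS
    rw [← SimpleGraph.card_neighborFinset_eq_degree]
    apply Finset.card_le_card_of_injOn (fun b : C => φ (p : V) (b : V))
    · intro b hb
      have hb' : C.toSimpleGraph.Adj p b := by simpa using hb
      exact hS b hb'
    · intro b hb b' hb' hbb
      have h1 : C.toSimpleGraph.Adj p b := by simpa using hb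
      have h2 : C.toSimpleGraph.Adj p b' := by simpa using hb'
      have g1 : H.Adj p b := h1
      have g2 : H.Adj p b' := h2
      exact Subtype.ext (hp p b b' g1.1 g2.1 hbb)
  have d2 : ∀ p : C, C.toSimpleGraph.degree p ≤ 2 := by
    intro p
    refine (key p {α, β} ?_).trans Finset.card_le_two
    intro b hb
    have : H.Adj p b := hb
    simpa using this.2
  have d1 : ∀ p : C, ((∀ b, G.Adj p b → φ p b ≠ α) ∨ (∀ b, G.Adj p b → φ p b ≠ β)) →
      C.toSimpleGraph.degree p ≤ 1 := by
    rintro p (h | h)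
    · refine (key p {β} ?_).trans (by simp)
      intro b hb
      have hb' : H.Adj p b := hb
      simpa using hb'.2.resolve_left (h b hb'.1)
    · refine (key p {α} ?_).trans (by simp)
      intro b hb
      have hb' : H.Adj p b := hb
      simpa using hb'.2.resolve_right (h b hb'.1)
  let E : Finset C := {⟨p₁, m1⟩, ⟨p₂, m2⟩, ⟨p₃, m3⟩}
  have hE : E.card = 3 := by
    rw [Finset.card_eq_three]
    exact ⟨_, _, _, by simpa using h12, by simpa using h13, by simpa using h23, rfl⟩
  have hb : ∑ p : C, (C.toSimpleGraph.degree p + if p ∈ E then 1 else 0) ≤ ∑ p : C, 2 := by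
    apply Finset.sum_le_sum
    intro p _
    split_ifs with h
    · have : C.toSimpleGraph.degree p ≤ 1 := by
        simp only [E, Finset.mem_insert, Finset.mem_singleton] at h
        rcases h with h | h | h <;> subst h
        · exact d1 _ e₁
        · exact d1 _ e₂
        · exact d1 _ e₃
      omega
    · have := d2 p
      omega
  rw [Finset.sum_add_distrib, hsum] at hb
  simp only [Finset.sum_boole, Finset.filter_univ_mem, Finset.sum_const, hE] at hb
  rw [Nat.card_eq_fintype_card, Nat.card_eq_fintype_card, ← SimpleGraph.edgeFinset_card] at hcard
  simp at hb
  simp only [← Nat.card_eq_fintype_card] at *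
  omega

variable {G : SimpleGraph V} [DecidableRel G.Adj] {x : V} {D : ℕ} {Low : V → Prop}

theorem no_common (hc : Ctx G x D Low) {v : V} {φ : V → V → ℕ} (h : Col G x D v φ) {c : ℕ}
    (hv : Miss G D φ v c) (hx : Miss G D φ x c) : False := by
  have hne : x ≠ v := h.adj.ne
  refine hc.hno (fun a b => if (a = x ∧ b = v) ∨ (a = v ∧ b = x) then c else φ a b) ⟨?_, ?_, ?_⟩
  · intro a b
    simp only [h.sym a b]
    congr 1
    exact propext (by tauto)
  · intro a b hab
    dsimp only
    split_ifs with hh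
    · exact Finset.mem_Icc.2 ⟨hv.1, hv.2.1⟩
    · refine Finset.mem_Icc.2 ⟨?_, h.le a b hab⟩
      have := (h.zero a b hab).not.2 hh
      omega
  · intro p a b ha hb hab
    dsimp only
    split_ifs with h1 h2 h2
    · exfalso
      rcases h1 with ⟨rfl, rfl⟩ | ⟨rfl, rfl⟩ <;> rcases h2 with ⟨h2, h3⟩ | ⟨h2, h3⟩ <;> simp_all
    · rcases h1 with ⟨rfl, rfl⟩ | ⟨rfl, rfl⟩
      · exact (hx.2.2 b hb).symm
      · exact (hv.2.2 b hb).symm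
    · rcases h2 with ⟨rfl, rfl⟩ | ⟨rfl, rfl⟩
      · exact hx.2.2 a ha
      · exact hv.2.2 a ha
    · exact fun he => hab (h.proper p a b ha hb he)

theorem exists_miss_pair {φ : V → V → ℕ} (c0 : ℕ) (p z : V)
    (hd : G.degree z + G.degree p + 2 ≤ D) :
    ∃ b, b ≠ c0 ∧ Miss G D φ p b ∧ Miss G D φ z b := by
  have hcard : (((G.neighborFinset p).image (φ p) ∪ (G.neighborFinset z).image (φ z)) ∪ {c0}).card
      < (Finset.Icc 1 D).card := by
    have h1 := Finset.card_union_le ((G.neighborFinset p).image (φ p) ∪ (G.neighborFinset z).image (φ z)) {c0}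
    have h2 := Finset.card_union_le ((G.neighborFinset p).image (φ p)) ((G.neighborFinset z).image (φ z))
    have h3 : ((G.neighborFinset p).image (φ p)).card ≤ G.degree p := Finset.card_image_le
    have h4 : ((G.neighborFinset z).image (φ z)).card ≤ G.degree z := Finset.card_image_le
    simp only [Nat.card_Icc, Finset.card_singleton] at *
    omega
  obtain ⟨b, hb, hb'⟩ := Finset.exists_mem_notMem_of_card_lt_card hcard
  rw [Finset.mem_Icc] at hb
  simp only [Finset.mem_union, Finset.mem_image, SimpleGraph.mem_neighborFinset,
    Finset.mem_singleton, not_or, not_exists, not_and] at hb'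
  exact ⟨b, hb'.2, ⟨hb.1, hb.2, fun a ha => hb'.1.1 a ha⟩, ⟨hb.1, hb.2, fun a ha => hb'.1.2 a ha⟩⟩

theorem exists_miss_of_zero (hdeg : ∀ v, G.degree v ≤ D) {φ : V → V → ℕ} {p a : V}
    (hpa : G.Adj p a) (h0 : φ p a = 0) : ∃ b, Miss G D φ p b := by
  have hcard : (((G.neighborFinset p).erase a).image (φ p)).card < (Finset.Icc 1 D).card := by
    have h3 : (((G.neighborFinset p).erase a).image (φ p)).card ≤ ((G.neighborFinset p).erase a).card :=
      Finset.card_image_le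
    have ha : a ∈ G.neighborFinset p := by simpa using hpa
    have h4 := Finset.card_erase_of_mem ha
    have h5 := Finset.card_pos.2 ⟨a, ha⟩
    have h6 := hdeg p
    rw [SimpleGraph.card_neighborFinset_eq_degree] at *
    simp only [Nat.card_Icc]
    omega
  obtain ⟨b, hb, hb'⟩ := Finset.exists_mem_notMem_of_card_lt_card hcard
  rw [Finset.mem_Icc] at hb
  simp only [Finset.mem_image, Finset.mem_erase, SimpleGraph.mem_neighborFinset,
    not_exists, not_and] at hb'
  refine ⟨b, hb.1, hb.2, fun c hc => ?_⟩
  by_cases hca : c = a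
  · subst hca; omega
  · exact hb' c ⟨hca, hc⟩

theorem Col.vx {v : V} {φ : V → V → ℕ} (h : Col G x D v φ) : φ v x = 0 :=
  (h.zero v x h.adj.symm).2 (Or.inr ⟨rfl, rfl⟩)

theorem Col.xv {v : V} {φ : V → V → ℕ} (h : Col G x D v φ) : φ x v = 0 :=
  (h.zero x v h.adj).2 (Or.inl ⟨rfl, rfl⟩)

theorem root_miss (hc : Ctx G x D Low) {v : V} {φ : V → V → ℕ} (h : Col G x D v φ) :
    ∃ γ, Miss G D φ v γ := exists_miss_of_zero hc.hdeg h.adj.symm h.vx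

theorem centre_miss (hc : Ctx G x D Low) {v : V} {φ : V → V → ℕ} (h : Col G x D v φ) :
    ∃ γ, Miss G D φ x γ := exists_miss_of_zero hc.hdeg h.adj h.xv

theorem miss_end {φ : V → V → ℕ} {z : V} {γ b : ℕ} (hz : Miss G D φ z γ ∨ Miss G D φ z b) :
    (∀ a, G.Adj z a → φ z a ≠ γ) ∨ (∀ a, G.Adj z a → φ z a ≠ b) :=
  hz.imp (fun h => h.2.2) (fun h => h.2.2)

theorem linked (hc : Ctx G x D Low) {v : V} {φ : V → V → ℕ} (h : Col G x D v φ) {γ b : ℕ}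
    (hv : Miss G D φ v γ) (hx : Miss G D φ x b) : x ∈ KK G φ h.sym γ b v := by
  by_contra hcon
  have hK := KK_clo (G := G) h.sym γ b v
  exact no_common hc (h.sw hK hv.1 hv.2.1 hx.1 hx.2.1)
    (miss_sw_right hK (KK_self h.sym γ b v) hx.1 hx.2.1 hv) ((miss_sw_notin hcon).2 hx)

theorem far (hc : Ctx G x D Low) {v : V} {φ : V → V → ℕ} (h : Col G x D v φ) {γ b : ℕ}
    (hv : Miss G D φ v γ) (hx : Miss G D φ x b) {z : V} (hzx : z ≠ x) (hzv : z ≠ v)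
    (hz : Miss G D φ z γ ∨ Miss G D φ z b) :
    x ∉ KK G φ h.sym γ b z ∧ v ∉ KK G φ h.sym γ b z := by
  have hl : (HH G φ h.sym γ b).Reachable v x := linked hc h hv hx
  have key : ¬ (x ∈ KK G φ h.sym γ b z ∧ v ∈ KK G φ h.sym γ b z) := fun hh =>
    three_ends h.sym h.proper hzx hzv h.adj.ne (miss_end hz) (miss_end (Or.inr hx))
      (miss_end (Or.inl hv)) hh.1 hh.2
  refine ⟨fun hh => key ⟨hh, ?_⟩, fun hh => key ⟨?_, hh⟩⟩
  · exact SimpleGraph.Reachable.trans hh hl.symm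
  · exact SimpleGraph.Reachable.trans hh hl

/-- The set `{v, z}` is closed when `vz` has colour `i` and both ends miss `γ`. -/
theorem pair_clo {v w : V} {φ : V → V → ℕ} (h : Col G x D w φ) {z : V} (hvz : G.Adj v z) {γ : ℕ}
    (hv : Miss G D φ v γ) (hz : Miss G D φ z γ) : Clo G φ (φ v z) γ {v, z} := by
  intro a b hab ha hcol
  simp only [Set.mem_insert_iff, Set.mem_singleton_iff] at *
  rcases ha with rfl | rfl
  · rcases hcol with hcol | hcol
    · exact Or.inr (h.proper a b z hab hvz hcol)
    · exact absurd hcol (hv.2.2 b hab)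
  · rcases hcol with hcol | hcol
    · rw [h.sym v a] at hcol
      exact Or.inl (h.proper a b v hab hvz.symm hcol)
    · exact absurd hcol (hz.2.2 b hab)


theorem sw_notin {φ : V → V → ℕ} {α β : ℕ} {K : Set V} {p : V} (hp : p ∉ K) (a : V) :
    sw α β K φ p a = φ p a := by
  simp [sw, hp]

/-- If `vz` is coloured `i ≠ 0` and both `v` and `z` miss `γ`, recolor `vz` with `γ`. -/
theorem recolor {v : V} {φ : V → V → ℕ} (h : Col G x D v φ) {z : V} (hvz : G.Adj v z)
    (hzx : z ≠ x) {γ : ℕ} (hv : Miss G D φ v γ) (hz : Miss G D φ z γ) :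
    ∃ φ', Col G x D v φ' ∧ Miss G D φ' v (φ v z) ∧ φ' v z = γ ∧
      (∀ b, G.Adj v b → b ≠ z → φ' v b = φ v b) ∧
      (∀ p, p ≠ v → p ≠ z → ∀ b, φ' p b = φ p b) := by
  have hK := pair_clo h hvz hv hz
  have hi0 : φ v z ≠ 0 := by
    rw [Ne, h.zero v z hvz]
    rintro (⟨h1, h2⟩ | ⟨h1, h2⟩)
    · exact h.adj.ne h1.symm
    · exact hzx h2
  have hiD := h.le v z hvz
  refine ⟨sw (φ v z) γ {v, z} φ, h.sw hK (by omega) hiD hv.1 hv.2.1,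
    miss_sw_left hK (by simp) (by omega) hiD hv, ?_, ?_, ?_⟩
  · rw [sw_edge hK hvz]; simp
  · intro b hvb hb
    unfold sw
    split_ifs with hh
    · have hbv : b = v := by simpa [hb] using hh.2
      exact absurd hbv hvb.ne'
    · rfl
  · intro p h1 h2 b
    exact sw_notin (by simp [h1, h2]) b

theorem miss_ext {φ φ' : V → V → ℕ} {p : V} {c : ℕ} (h : ∀ b, G.Adj p b → φ' p b = φ p b) :
    Miss G D φ' p c ↔ Miss G D φ p c := by
  unfold Miss
  refine and_congr_right fun _ => and_congr_right fun _ => forall_congr' fun b => forall_congr' fun hb => ?_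
  rw [h b hb]

theorem MM_ext {φ φ' : V → V → ℕ} {p : V} {c : ℕ} (h : ∀ b, G.Adj p b → φ' p b = φ p b) :
    MM G D Low φ' p c ↔ MM G D Low φ p c := by
  unfold MM
  rw [miss_ext h]
  refine or_congr Iff.rfl (exists_congr fun z => and_congr_right fun hz => ?_)
  rw [h z hz]

/-- a vertex missing or low-coloured `i` at the root can be made to miss `i`. -/
theorem acquire (hc : Ctx G x D Low) {v : V} {φ : V → V → ℕ} (h : Col G x D v φ) {i : ℕ}
    (hi : MM G D Low φ v i) (c0 : ℕ) (hc0 : Miss G D φ x c0) :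
    ∃ φ', Col G x D v φ' ∧ Miss G D φ' v i ∧ (∀ p, φ' x p = φ x p) ∧
      (∀ c, MM G D Low φ v c → MM G D Low φ' v c) ∧
      (∀ p, G.Adj x p → p ≠ v → ∀ c, ¬ Miss G D φ x c → (c = i ∨ ¬ MM G D Low φ v c) →
        MM G D Low φ p c → MM G D Low φ' p c) ∧
      (∀ p, G.Adj x p → p ≠ v → MM G D Low φ p c0 → MM G D Low φ' p c0) := by
  by_cases hm : Miss G D φ v i
  · exact ⟨φ, h, hm, fun _ => rfl, fun _ => id, fun _ _ _ _ _ _ => id, fun _ _ _ => id⟩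
  obtain ⟨z, hvz, hz, rfl⟩ := hi.resolve_left hm
  obtain ⟨γ, hγ⟩ := root_miss hc h
  obtain ⟨hxz, hzx⟩ := hc.lowx z hz
  obtain ⟨b, hb0, hbx, hbz⟩ := exists_miss_pair (φ := φ) c0 x z (hc.lowdeg z hz)
  have hzv : z ≠ v := hvz.ne'
  obtain ⟨f1, f2⟩ := far hc h hγ hbx hzx hzv (Or.inr hbz)
  have hK := KK_clo (G := G) h.sym γ b z
  have hKz := KK_self (G := G) h.sym γ b z
  have h1 := h.sw hK hγ.1 hγ.2.1 hbx.1 hbx.2.1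
  set φ1 := sw γ b (KK G φ h.sym γ b z) φ with hφ1
  have hv1 : ∀ a, φ1 v a = φ v a := fun a => sw_notin f2 a
  have hx1 : ∀ a, φ1 x a = φ x a := fun a => sw_notin f1 a
  have hγ1 : Miss G D φ1 v γ := (miss_ext fun a _ => hv1 a).2 hγ
  have hz1 : Miss G D φ1 z γ := miss_sw_left hK hKz hγ.1 hγ.2.1 hbz
  obtain ⟨φ2, h2, g1, g2, g3, g4⟩ := recolor h1 hvz hzx hγ1 hz1
  have hγc0 : c0 ≠ γ := by
    rintro rfl
    exact no_common hc h hγ hc0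
  refine ⟨φ2, h2, by rwa [hv1 z] at g1, ?_, ?_, ?_, ?_⟩
  · intro p
    rw [g4 x h.adj.ne hzx.symm p, hx1]
  · intro c hcM
    rcases hcM with hcM | ⟨z', hvz', hz', rfl⟩
    · by_cases hcγ : c = γ
      · subst hcγ
        exact Or.inr ⟨z, hvz, hz, g2⟩
      · refine Or.inl ⟨hcM.1, hcM.2.1, fun a ha => ?_⟩
        by_cases haz : a = z
        · subst haz
          rw [g2]
          exact fun hh => hcγ hh.symm
        · rw [g3 a ha haz, hv1]
          exact hcM.2.2 a ha
    · by_cases haz : z' = z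
      · subst haz
        exact Or.inl (by rwa [hv1 z'] at g1)
      · exact Or.inr ⟨z', hvz', hz', by rw [g3 z' hvz' haz, hv1]⟩
  · intro p hp hpv c hcx hci hM
    have hpz : p ≠ z := by
      rintro rfl
      exact hxz hp
    rw [MM_ext (φ := φ1) (fun a _ => g4 p hpv hpz a), MM_sw_other hK]
    · exact hM
    · rintro rfl
      rcases hci with rfl | hci
      · exact hγ.2.2 z hvz rfl
      · exact hci (Or.inl hγ)
    · rintro rfl
      exact hcx hbx
  · intro p hp hpv hM
    have hpz : p ≠ z := by
      rintro rfl
      exact hxz hp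
    rw [MM_ext (φ := φ1) (fun a _ => g4 p hpv hpz a), MM_sw_other hK hγc0 hb0.symm]
    exact hM

/-- shift the uncoloured edge. -/
theorem rotate (hc : Ctx G x D Low) {v : V} {φ : V → V → ℕ} (h : Col G x D v φ) {u : V}
    (hu : G.Adj x u) (hm : Miss G D φ v (φ x u)) :
    ∃ φ', Col G x D u φ' ∧ φ' x v = φ x u ∧ (∀ p, G.Adj x p → p ≠ v → p ≠ u → φ' x p = φ x p) ∧
      (∀ c, Miss G D φ' x c ↔ Miss G D φ x c) ∧
      (∀ p, G.Adj x p → p ≠ v → ∀ c, MM G D Low φ p c → MM G D Low φ' p c) ∧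
      MM G D Low φ' u (φ x u) ∧
      (∀ c, c ≠ φ x u → MM G D Low φ v c → MM G D Low φ' v c) := by
  set a := φ x u with ha
  have ha1 := hm.1
  have haD := hm.2.1
  have hxv := h.adj
  have huv : u ≠ v := by
    rintro rfl
    have := h.xv
    omega
  have hK : Clo G φ 0 a {v, x, u} := by
    intro p q hpq hp hcol
    simp only [Set.mem_insert_iff, Set.mem_singleton_iff] at *
    rcases hcol with hcol | hcol
    · rw [h.zero p q hpq] at hcol
      tauto
    · rcases hp with rfl | rfl | rfl
      · exact absurd hcol (hm.2.2 q hpq)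
      · exact Or.inr (Or.inr (h.proper p q u hpq hu (hcol.trans ha)))
      · rw [ha, h.sym x p] at hcol
        exact Or.inr (Or.inl (h.proper p q x hpq hu.symm hcol))
  set φ' := sw 0 a {v, x, u} φ with hφ'
  have e : ∀ {p q}, G.Adj p q → φ' p q = if p ∈ ({v, x, u} : Set V) then Equiv.swap 0 a (φ p q) else φ p q :=
    by
    intro p q hpq
    convert sw_edge hK hpq
  have oth : ∀ {p q} {c : ℕ}, G.Adj p q → c ≠ 0 → c ≠ a → (φ' p q = c ↔ φ p q = c) :=
    fun hpq h1 h2 => sw_other hK hpq h1 h2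
  have hMo : ∀ {p c}, c ≠ a → MM G D Low φ p c → MM G D Low φ' p c := by
    rintro p c hca (h1 | ⟨z, hpz, hz, rfl⟩)
    · exact Or.inl ((miss_sw_other hK (by have := h1.1; omega) hca).2 h1)
    · by_cases h0 : φ p z = 0
      · rw [h.zero p z hpz] at h0
        rcases h0 with ⟨rfl, rfl⟩ | ⟨rfl, rfl⟩
        · exact absurd hxv (hc.lowx z hz).1
        · exact absurd rfl (hc.lowx z hz).2
      · exact Or.inr ⟨z, hpz, hz, (oth hpz h0 hca).2 rfl⟩
  have hua : Miss G D φ' u a := by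
    refine ⟨ha1, haD, fun q hq hh => ?_⟩
    rw [e hq, if_pos (by simp), Equiv.swap_apply_eq_iff, Equiv.swap_apply_right, h.zero u q hq] at hh
    rcases hh with ⟨h1, -⟩ | ⟨h1, -⟩
    · exact hu.ne h1.symm
    · exact huv h1
  have hxv' : φ' x v = a := by
    rw [e hxv, if_pos (by simp), h.xv]; simp
  have hxu' : φ' x u = 0 := by
    rw [e hu, if_pos (by simp), ← ha]; simp
  refine ⟨φ', ⟨hu, sw_sym h.sym, sw_le h.le (Nat.zero_le _) haD, sw_proper hK h.proper, ?_⟩, hxv', ?_, ?_, ?_,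
    Or.inl hua, fun c hca hM => hMo hca hM⟩
  · intro p q hpq
    constructor
    · intro hh
      rw [e hpq] at hh
      split_ifs at hh with hp
      · rw [Equiv.swap_apply_eq_iff, Equiv.swap_apply_left] at hh
        simp only [Set.mem_insert_iff, Set.mem_singleton_iff] at hp
        rcases hp with rfl | rfl | rfl
        · exact absurd hh (hm.2.2 q hpq)
        · exact Or.inl ⟨rfl, h.proper p q u hpq hu (hh.trans ha)⟩
        · rw [ha, h.sym x p] at hh
          exact Or.inr ⟨rfl, h.proper p q x hpq hu.symm hh⟩
      · rw [h.zero p q hpq] at hh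
        exfalso
        apply hp
        rcases hh with ⟨rfl, -⟩ | ⟨rfl, -⟩ <;> simp
    · rintro (⟨rfl, rfl⟩ | ⟨rfl, rfl⟩)
      · exact hxu'
      · rw [hφ', sw_sym h.sym]; exact hxu'
  · intro p hp hpv hpu
    rw [e hp, if_pos (by simp)]
    apply Equiv.swap_apply_of_ne_of_ne
    · intro h0
      rw [h.zero x p hp] at h0
      rcases h0 with ⟨-, h0⟩ | ⟨h0, -⟩
      · exact hpv h0
      · exact hxv.ne h0
    · intro h0
      exact hpu (h.proper x p u hp hu (h0.trans ha))
  · intro c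
    by_cases hca : c = a
    · subst hca
      constructor
      · intro hh; exact absurd hxv' (hh.2.2 v hxv)
      · intro hh; exact absurd ha.symm (hh.2.2 u hu)
    · by_cases hc0 : c = 0
      · subst hc0
        constructor <;> intro hh <;> exact absurd hh.1 (by omega)
      · exact miss_sw_other hK hc0 hca
  · intro p hp hpv c hM
    by_cases hpu : p = u
    · subst hpu
      by_cases hca : c = a
      · subst hca; exact Or.inl hua
      · exact hMo hca hM
    · have hpK : p ∉ ({v, x, u} : Set V) := by
        simp only [Set.mem_insert_iff, Set.mem_singleton_iff, not_or]
        exact ⟨hpv, hp.ne', hpu⟩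
      exact (MM_sw_notin hpK).2 hM

/-- If the root misses `i` and `u` also has `i`, turn `i` at `u` into a color missing at `x`. -/
theorem convert_color (hc : Ctx G x D Low) {v : V} {φ : V → V → ℕ} (h : Col G x D v φ) {i : ℕ}
    (hi : Miss G D φ v i) {u : V} (hu : G.Adj x u) (huv : u ≠ v) (hM : MM G D Low φ u i) :
    ∃ φ' c, Col G x D v φ' ∧ Miss G D φ' x c ∧ MM G D Low φ' u c ∧ (∀ p, φ' x p = φ x p) ∧
      (∀ p, φ' v p = φ v p) ∧
      (∀ p e, e ≠ i → ¬ Miss G D φ x e → MM G D Low φ p e → MM G D Low φ' p e) := by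
  rcases hM with hM | ⟨z, huz, hz, hui⟩
  · obtain ⟨c, hcx⟩ := centre_miss hc h
    obtain ⟨f1, f2⟩ := far hc h hi hcx hu.ne' huv (Or.inl hM)
    have hK := KK_clo (G := G) h.sym i c u
    refine ⟨_, c, h.sw hK hi.1 hi.2.1 hcx.1 hcx.2.1, (miss_sw_notin f1).2 hcx,
      Or.inl (miss_sw_right hK (KK_self h.sym i c u) hcx.1 hcx.2.1 hM), sw_notin f1, sw_notin f2, ?_⟩
    intro p e he1 he2 hM
    refine (MM_sw_other hK he1 ?_).2 hM
    rintro rfl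
    exact he2 hcx
  · obtain ⟨hxz, hzx⟩ := hc.lowx z hz
    obtain ⟨c, -, hcx, hcz⟩ := exists_miss_pair (φ := φ) 0 x z (hc.lowdeg z hz)
    have hzv : z ≠ v := by
      rintro rfl
      exact hxz h.adj
    obtain ⟨f1, f2⟩ := far hc h hi hcx hzx hzv (Or.inr hcz)
    have hK := KK_clo (G := G) h.sym i c z
    refine ⟨_, c, h.sw hK hi.1 hi.2.1 hcx.1 hcx.2.1, (miss_sw_notin f1).2 hcx,
      Or.inr ⟨z, huz, hz, ?_⟩, sw_notin f1, sw_notin f2, ?_⟩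
    · rw [sw_sym h.sym, sw_edge hK huz.symm, if_pos (KK_self h.sym i c z), h.sym z u, hui]
      simp
    · intro p e he1 he2 hM
      refine (MM_sw_other hK he1 ?_).2 hM
      rintro rfl
      exact he2 hcx

theorem MM_pos (hc : Ctx G x D Low) {v : V} {φ : V → V → ℕ} (h : Col G x D v φ) {p : V} {c : ℕ}
    (hM : MM G D Low φ p c) : 1 ≤ c := by
  rcases hM with hM | ⟨z, hpz, hz, rfl⟩
  · exact hM.1
  · by_contra h0
    have h0 : φ p z = 0 := by omega
    rw [h.zero p z hpz] at h0
    rcases h0 with ⟨rfl, rfl⟩ | ⟨rfl, rfl⟩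
    · exact absurd h.adj (hc.lowx z hz).1
    · exact absurd rfl (hc.lowx z hz).2

/-- chains of neighbours of `x`. -/
def Ch (G : SimpleGraph V) [DecidableRel G.Adj] (x : V) (D : ℕ) (Low : V → Prop) (φ : V → V → ℕ) :
    V → List V → Prop
  | _, [] => True
  | p, u :: l => G.Adj x u ∧ MM G D Low φ p (φ x u) ∧ Ch G x D Low φ u l

/-- last vertex of a chain. -/
def lst : V → List V → V
  | p, [] => p
  | _, u :: l => lst u l

theorem lst_mem : ∀ (l : List V) (p : V), lst p l ∈ p :: l
  | [], p => by simp [lst]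
  | u :: l, p => by
    have := lst_mem l u
    exact List.mem_cons_of_mem _ this

theorem Ch_mono {φ φ' : V → V → ℕ} : ∀ (l : List V) (p : V), Ch G x D Low φ p l →
    (∀ u ∈ l, φ' x u = φ x u) →
    (∀ q ∈ p :: l, ∀ u ∈ l, MM G D Low φ q (φ x u) → MM G D Low φ' q (φ x u)) →
    Ch G x D Low φ' p l
  | [], _, _, _, _ => trivial
  | u :: l, p, ⟨h1, h2, h3⟩, hx, hM => by
    refine ⟨h1, ?_, Ch_mono l u h3 (fun w hw => hx w (List.mem_cons_of_mem _ hw))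
      (fun q hq w hw => hM q (List.mem_cons_of_mem _ hq) w (List.mem_cons_of_mem _ hw))⟩
    rw [hx u (by simp)]
    exact hM p (by simp) u (by simp) h2

theorem Ch_info (hc : Ctx G x D Low) {v : V} {φ : V → V → ℕ} (h : Col G x D v φ) :
    ∀ (l : List V) (p : V), Ch G x D Low φ p l → ∀ u ∈ l, G.Adj x u ∧ u ≠ v
  | [], _, _, u, hu => by simp at hu
  | w :: l, p, ⟨h1, h2, h3⟩, u, hu => by
    rcases List.mem_cons.1 hu with rfl | hu
    · refine ⟨h1, ?_⟩
      rintro rfl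
      have := MM_pos hc h h2
      have := h.xv
      omega
    · exact Ch_info hc h l w h3 u hu

theorem Ch_suffix {φ : V → V → ℕ} : ∀ (l : List V) (p : V), Ch G x D Low φ p l → ∀ u ∈ l,
    ∃ t, Ch G x D Low φ u t ∧ lst u t = lst p l ∧ t.length < l.length
  | [], _, _, u, hu => by simp at hu
  | w :: l, p, ⟨h1, h2, h3⟩, u, hu => by
    rcases List.mem_cons.1 hu with rfl | hu
    · exact ⟨l, h3, rfl, by simp⟩
    · obtain ⟨t, a, b, c⟩ := Ch_suffix l w h3 u hu
      exact ⟨t, a, b, by simp; omega⟩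

theorem Ch_append {φ : V → V → ℕ} : ∀ (l : List V) (p u : V), Ch G x D Low φ p l → G.Adj x u →
    MM G D Low φ (lst p l) (φ x u) → Ch G x D Low φ p (l ++ [u]) ∧ lst p (l ++ [u]) = u
  | [], _, u, _, h1, h2 => ⟨⟨h1, h2, trivial⟩, rfl⟩
  | w :: l, p, u, ⟨h1, h2, h3⟩, h4, h5 => by
    obtain ⟨a, b⟩ := Ch_append l w u h3 h4 h5
    exact ⟨⟨h1, h2, a⟩, b⟩

theorem shortcut {φ : V → V → ℕ} {v : V} : ∀ (n : ℕ) (l : List V) (v1 : V), l.length ≤ n →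
    G.Adj x v1 → MM G D Low φ v (φ x v1) → Ch G x D Low φ v1 l →
    ∃ u t, G.Adj x u ∧ MM G D Low φ v (φ x u) ∧ Ch G x D Low φ u t ∧ lst u t = lst v1 l ∧
      t.length ≤ l.length ∧ ∀ w ∈ t, ¬ MM G D Low φ v (φ x w) := by
  intro n
  induction n with
  | zero =>
    intro l v1 hl h1 h2 h3
    have : l = [] := List.length_eq_zero_iff.1 (by omega)
    subst this
    exact ⟨v1, [], h1, h2, h3, rfl, le_rfl, by simp⟩
  | succ n ih =>
    intro l v1 hl h1 h2 h3
    by_cases hex : ∃ w ∈ l, MM G D Low φ v (φ x w)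
    · obtain ⟨w, hw, hwM⟩ := hex
      obtain ⟨t, a, b, c⟩ := Ch_suffix l v1 h3 w hw
      have hadj : G.Adj x w := by
        clear ih hl b c a t hwM h2
        induction l generalizing v1 with
        | nil => simp at hw
        | cons y l ih =>
          rcases List.mem_cons.1 hw with rfl | hw
          · exact h3.1
          · exact ih y h3.1 h3.2.2 hw
      obtain ⟨u, t', g1, g2, g3, g4, g5, g6⟩ := ih t w (by omega) hadj hwM a
      exact ⟨u, t', g1, g2, g3, g4.trans b, by omega, g6⟩
    · push Not at hex
      exact ⟨v1, l, h1, h2, h3, rfl, le_rfl, hex⟩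

theorem not_miss_seen {φ : V → V → ℕ} {u : V} (hu : G.Adj x u) : ¬ Miss G D φ x (φ x u) :=
  fun hh => hh.2.2 u hu rfl

theorem PP (hc : Ctx G x D Low) : ∀ (n : ℕ) (l : List V) (v : V) (φ : V → V → ℕ) (c0 : ℕ),
    l.length ≤ n → Col G x D v φ → Ch G x D Low φ v l → Miss G D φ x c0 →
    MM G D Low φ (lst v l) c0 → False := by
  intro n
  induction n with
  | zero =>
    intro l v φ c0 hl h hch hm hM
    have : l = [] := List.length_eq_zero_iff.1 (by omega)
    subst this
    obtain ⟨φ', h', hv, hx', -⟩ := acquire hc h hM c0 hm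
    exact no_common hc h' hv ((miss_ext fun b _ => hx' b).2 hm)
  | succ n ih =>
    intro l v φ c0 hl h hch hm hM
    rcases l with _ | ⟨v1, l⟩
    · exact ih [] v φ c0 (by simp) h hch hm hM
    obtain ⟨k1, k2, k3⟩ := hch
    obtain ⟨u, t, g1, g2, g3, g4, g5, g6⟩ := shortcut l.length l v1 le_rfl k1 k2 k3
    have hM : MM G D Low φ (lst u t) c0 := by
      rw [g4]; exact hM
    have hin : ∀ p ∈ u :: t, G.Adj x p ∧ p ≠ v := Ch_info hc h (u :: t) v ⟨g1, g2, g3⟩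
    obtain ⟨φ1, h1, a1, a2, a3, a4, a5⟩ := acquire hc h g2 c0 hm
    have a1 : Miss G D φ1 v (φ1 x u) := by rwa [a2]
    obtain ⟨φ2, h2, b1, b2, b3, b4, b5, b6⟩ := rotate hc h1 g1 a1
    have hlast := hin _ (lst_mem t u)
    have hch1 : Ch G x D Low φ1 u t := by
      refine Ch_mono t u g3 (fun w _ => a2 w) (fun q hq w hw => ?_)
      exact a4 q (hin q hq).1 (hin q hq).2 _ (not_miss_seen (hin w (List.mem_cons_of_mem _ hw)).1)
        (Or.inr (g6 w hw))
    have hut : u ∉ t := fun hh => g6 u hh g2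
    refine ih t u φ2 c0 (by simp at hl; omega) h2 ?_ ((b3 c0).2 ((miss_ext fun b _ => a2 b).2 hm)) ?_
    · refine Ch_mono t u hch1 (fun w hw => ?_) (fun q hq w hw => ?_)
      · have := hin w (List.mem_cons_of_mem _ hw)
        exact b2 w this.1 this.2 (fun e => hut (e ▸ hw))
      · exact b4 q (hin q hq).1 (hin q hq).2 _
    · exact b4 _ hlast.1 hlast.2 _ (a5 _ hlast.1 hlast.2 hM)

theorem QQ (hc : Ctx G x D Low) (v1 : V) (l : List V) (v : V) (φ : V → V → ℕ) (i : ℕ)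
    (h : Col G x D v φ) (hch : Ch G x D Low φ v (v1 :: l)) (hv : MM G D Low φ v i)
    (hM : MM G D Low φ (lst v1 l) i) : False := by
  by_cases hix : Miss G D φ x i
  · exact PP hc _ (v1 :: l) v φ i le_rfl h hch hix hM
  obtain ⟨k1, k2, k3⟩ := hch
  obtain ⟨u, t, g1, g2, g3, g4, g5, g6⟩ := shortcut l.length l v1 le_rfl k1 k2 k3
  rw [← g4] at hM
  have hin : ∀ p ∈ u :: t, G.Adj x p ∧ p ≠ v := Ch_info hc h (u :: t) v ⟨g1, g2, g3⟩
  obtain ⟨c0, hc0⟩ := centre_miss hc h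
  obtain ⟨φ1, h1, a1, a2, a3, a4, a5⟩ := acquire hc h hv c0 hc0
  have hlast := hin _ (lst_mem t u)
  have hch1 : Ch G x D Low φ1 u t := by
    refine Ch_mono t u g3 (fun w _ => a2 w) (fun q hq w hw => ?_)
    exact a4 q (hin q hq).1 (hin q hq).2 _ (not_miss_seen (hin w (List.mem_cons_of_mem _ hw)).1)
      (Or.inr (g6 w hw))
  obtain ⟨φ2, c, h2, b1, b2, b3, b4, b5⟩ := convert_color hc h1 a1 hlast.1 hlast.2
    (a4 _ hlast.1 hlast.2 i hix (Or.inl rfl) hM)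
  refine PP hc _ (u :: t) v φ2 c le_rfl h2 ⟨g1, ?_, ?_⟩ b1 b2
  · rw [b3, a2]
    exact (MM_ext fun b _ => b4 b).2 (a3 _ g2)
  · refine Ch_mono t u hch1 (fun w _ => b3 w) (fun q hq w hw => ?_)
    refine b5 q _ ?_ (not_miss_seen (hin w (List.mem_cons_of_mem _ hw)).1)
    rw [a2]
    rintro rfl
    exact g6 w hw hv

theorem QQ2 (hc : Ctx G x D Low) : ∀ (n : ℕ) (l1 l2 : List V) (v : V) (φ : V → V → ℕ) (i : ℕ),
    l1.length ≤ n → Col G x D v φ → Ch G x D Low φ v l1 → Ch G x D Low φ v l2 →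
    lst v l1 ≠ lst v l2 → MM G D Low φ (lst v l1) i → MM G D Low φ (lst v l2) i → False := by
  intro n
  induction n with
  | zero =>
    intro l1 l2 v φ i hl h hch1 hch2 hne hM1 hM2
    have : l1 = [] := List.length_eq_zero_iff.1 (by omega)
    subst this
    rcases l2 with _ | ⟨u1, l2⟩
    · exact hne rfl
    · exact QQ hc u1 l2 v φ i h hch2 hM1 hM2
  | succ n ih =>
    intro l1 l2 v φ i hl h hch1 hch2 hne hM1 hM2
    rcases l1 with _ | ⟨v1, l1⟩
    · exact ih [] l2 v φ i (by simp) h hch1 hch2 hne hM1 hM2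
    rcases l2 with _ | ⟨u1, l2⟩
    · exact QQ hc v1 l1 v φ i h hch1 hM2 hM1
    by_cases hvi : MM G D Low φ v i
    · exact QQ hc v1 l1 v φ i h hch1 hvi hM1
    by_cases hxi : Miss G D φ x i
    · exact PP hc _ (v1 :: l1) v φ i le_rfl h hch1 hxi hM1
    obtain ⟨k1, k2, k3⟩ := hch1
    obtain ⟨k1', k2', k3'⟩ := hch2
    obtain ⟨u, t, g1, g2, g3, g4, g5, g6⟩ := shortcut l1.length l1 v1 le_rfl k1 k2 k3
    obtain ⟨u', t', g1', g2', g3', g4', g5', g6'⟩ := shortcut l2.length l2 u1 le_rfl k1' k2' k3'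
    have hM1 : MM G D Low φ (lst u t) i := by rw [g4]; exact hM1
    have hM2 : MM G D Low φ (lst u' t') i := by rw [g4']; exact hM2
    have hne : lst u t ≠ lst u' t' := by rw [g4, g4']; exact hne
    have hin : ∀ p ∈ u :: t, G.Adj x p ∧ p ≠ v := Ch_info hc h (u :: t) v ⟨g1, g2, g3⟩
    have hin' : ∀ p ∈ u' :: t', G.Adj x p ∧ p ≠ v := Ch_info hc h (u' :: t') v ⟨g1', g2', g3'⟩
    obtain ⟨c0, hc0⟩ := centre_miss hc h
    obtain ⟨φ1, h1, a1, a2, a3, a4, a5⟩ := acquire hc h g2 c0 hc0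
    have a1 : Miss G D φ1 v (φ1 x u) := by rwa [a2]
    obtain ⟨φ2, h2, b1, b2, b3, b4, b5, b6⟩ := rotate hc h1 g1 a1
    have hlast := hin _ (lst_mem t u)
    have hlast' := hin' _ (lst_mem t' u')
    have hut : u ∉ t := fun hh => g6 u hh g2
    have hut' : u ∉ t' := fun hh => g6' u hh g2
    have hch : Ch G x D Low φ2 u t := by
      refine Ch_mono t u g3 (fun w hw => ?_) (fun q hq w hw hM => ?_)
      · have := hin w (List.mem_cons_of_mem _ hw)
        rw [b2 w this.1 this.2 (fun e => hut (e ▸ hw)), a2]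
      · refine b4 q (hin q hq).1 (hin q hq).2 _ ?_
        exact a4 q (hin q hq).1 (hin q hq).2 _ (not_miss_seen (hin w (List.mem_cons_of_mem _ hw)).1)
          (Or.inr (g6 w hw)) hM
    have hch' : Ch G x D Low φ2 u' t' := by
      refine Ch_mono t' u' g3' (fun w hw => ?_) (fun q hq w hw hM => ?_)
      · have := hin' w (List.mem_cons_of_mem _ hw)
        rw [b2 w this.1 this.2 (fun e => hut' (e ▸ hw)), a2]
      · refine b4 q (hin' q hq).1 (hin' q hq).2 _ ?_
        exact a4 q (hin' q hq).1 (hin' q hq).2 _ (not_miss_seen (hin' w (List.mem_cons_of_mem _ hw)).1)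
          (Or.inr (g6' w hw)) hM
    have hN1 : MM G D Low φ2 (lst u t) i :=
      b4 _ hlast.1 hlast.2 _ (a4 _ hlast.1 hlast.2 _ hxi (Or.inr hvi) hM1)
    have hN2 : MM G D Low φ2 (lst u' t') i :=
      b4 _ hlast'.1 hlast'.2 _ (a4 _ hlast'.1 hlast'.2 _ hxi (Or.inr hvi) hM2)
    have hl' : t.length ≤ n := by simp at hl; omega
    by_cases huu : u' = u
    · subst huu
      exact ih t t' u' φ2 i hl' h2 hch hch' hne hN1 hN2
    · refine ih t (v :: u' :: t') u φ2 i hl' h2 hch ⟨h.adj, ?_, g1', ?_, hch'⟩ hne hN1 hN2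
      · rw [b1]; exact b5
      · rw [b2 u' g1' (hin' u' (by simp)).2 huu, a2]
        refine b6 _ ?_ (a3 _ g2')
        rw [a2]
        exact fun hh => huu (h.proper x u' u g1' g1 hh)

theorem fan (hc : Ctx G x D Low) {w : V} {φ : V → V → ℕ} (h : Col G x D w φ) :
    ∃ R : Finset V, w ∈ R ∧ R ⊆ G.neighborFinset x ∧
      ∑ u ∈ R, ((G.neighborFinset u).filter Low).card + 2 ≤ R.card := by
  set R : Finset V := Finset.univ.filter fun u => G.Adj x u ∧ ∃ l, Ch G x D Low φ w l ∧ lst w l = u with hR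
  have memR : ∀ u, u ∈ R ↔ G.Adj x u ∧ ∃ l, Ch G x D Low φ w l ∧ lst w l = u := by
    intro u; simp [hR]
  have hw : w ∈ R := (memR w).2 ⟨h.adj, [], trivial, rfl⟩
  refine ⟨R, hw, fun u hu => by simpa using ((memR u).1 hu).1, ?_⟩
  set mm : V → Finset ℕ := fun u => (Finset.Icc 1 D).filter fun c => MM G D Low φ u c with hmm
  have mem_mm : ∀ u c, MM G D Low φ u c → c ∈ mm u := by
    intro u c hM
    refine Finset.mem_filter.2 ⟨Finset.mem_Icc.2 ⟨MM_pos hc h hM, ?_⟩, hM⟩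
    rcases hM with hM | ⟨z, hz, -, rfl⟩
    · exact hM.2.1
    · exact h.le _ _ hz
  have hdis : ∀ u ∈ R, ∀ u' ∈ R, u ≠ u' → Disjoint (mm u) (mm u') := by
    intro u hu u' hu' hne
    rw [Finset.disjoint_left]
    intro c h1 h2
    obtain ⟨-, l, hl, rfl⟩ := (memR u).1 hu
    obtain ⟨-, l', hl', rfl⟩ := (memR u').1 hu'
    exact QQ2 hc _ l l' w φ c le_rfl h hl hl' hne (Finset.mem_filter.1 h1).2 (Finset.mem_filter.1 h2).2
  have hsub : R.biUnion mm ⊆ (R.erase w).image (φ x) := by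
    intro c hcm
    obtain ⟨u, hu, hcu⟩ := Finset.mem_biUnion.1 hcm
    obtain ⟨hIcc, hM⟩ := Finset.mem_filter.1 hcu
    obtain ⟨-, l, hl, rfl⟩ := (memR u).1 hu
    have hnm : ¬ Miss G D φ x c := fun hm => PP hc _ l w φ c le_rfl h hl hm hM
    have hI := Finset.mem_Icc.1 hIcc
    unfold Miss at hnm
    push Not at hnm
    obtain ⟨b, hb, rfl⟩ := hnm hI.1 hI.2
    obtain ⟨q1, q2⟩ := Ch_append l w b hl hb hM
    refine Finset.mem_image.2 ⟨b, Finset.mem_erase.2 ⟨?_, (memR b).2 ⟨hb, _, q1, q2⟩⟩, rfl⟩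
    rintro rfl
    have := h.xv
    omega
  have hcard := (Finset.card_le_card hsub).trans Finset.card_image_le
  rw [Finset.card_biUnion hdis, Finset.card_erase_of_mem hw] at hcard
  have hinj : ∀ u, Set.InjOn (φ u) ((G.neighborFinset u).filter Low : Finset V) := by
    intro u a ha b hb hab
    simp only [Finset.coe_filter, SimpleGraph.mem_neighborFinset, Set.mem_ofPred_eq] at ha hb
    exact h.proper u a b ha.1 hb.1 hab
  have hsu : ∀ u, ((G.neighborFinset u).filter Low).image (φ u) ⊆ mm u := by
    intro u c hcc
    obtain ⟨z, hz, rfl⟩ := Finset.mem_image.1 hcc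
    simp only [Finset.mem_filter, SimpleGraph.mem_neighborFinset] at hz
    exact mem_mm _ _ (Or.inr ⟨z, hz.1, hz.2, rfl⟩)
  have hle : ∀ u, ((G.neighborFinset u).filter Low).card ≤ (mm u).card := by
    intro u
    rw [← Finset.card_image_of_injOn (hinj u)]
    exact Finset.card_le_card (hsu u)
  have hlt : ((G.neighborFinset w).filter Low).card < (mm w).card := by
    rw [← Finset.card_image_of_injOn (hinj w)]
    obtain ⟨γ, hγ⟩ := root_miss hc h
    refine Finset.card_lt_card ⟨hsu w, fun hh => ?_⟩
    obtain ⟨z, hz, hzc⟩ := Finset.mem_image.1 (hh (mem_mm w γ (Or.inl hγ)))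
    simp only [Finset.mem_filter, SimpleGraph.mem_neighborFinset] at hz
    exact hγ.2.2 z hz.1 hzc
  have := Finset.sum_lt_sum (fun u _ => hle u) ⟨w, hw, hlt⟩
  omega

theorem F0 (hc : Ctx G x D Low) {w : V} {φ : V → V → ℕ} (h : Col G x D w φ) {z : V} (hwz : G.Adj w z)
    (hzx : z ≠ x) (hm : Miss G D φ x (φ w z)) {γ η : ℕ} (hγ : Miss G D φ w γ) (hη : Miss G D φ z η) :
    w ∈ KK G φ h.sym γ η z := by
  by_contra hcon
  have hK := KK_clo (G := G) h.sym γ η z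
  have hKz := KK_self (G := G) h.sym γ η z
  have h1 := h.sw hK hγ.1 hγ.2.1 hη.1 hη.2.1
  set φ1 := sw γ η (KK G φ h.sym γ η z) φ with hφ1
  have hv1 : ∀ a, φ1 w a = φ w a := fun a => sw_notin hcon a
  have hγ1 : Miss G D φ1 w γ := (miss_ext fun a _ => hv1 a).2 hγ
  have hz1 : Miss G D φ1 z γ := miss_sw_left hK hKz hγ.1 hγ.2.1 hη
  have hx1 : Miss G D φ1 x (φ w z) := by
    refine (miss_sw_other hK (hγ.2.2 z hwz) ?_).2 hm
    rw [h.sym w z]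
    exact hη.2.2 w hwz.symm
  obtain ⟨φ2, h2, g1, g2, g3, g4⟩ := recolor h1 hwz hzx hγ1 hz1
  rw [hv1] at g1
  exact no_common hc h2 g1 ((miss_ext fun a _ => g4 x h.adj.ne hzx.symm a).2 hx1)

theorem KK_comm {φ : V → V → ℕ} {hs : ∀ a b, φ a b = φ b a} {α β : ℕ} {a b : V}
    (h : a ∈ KK G φ hs α β b) : b ∈ KK G φ hs α β a :=
  SimpleGraph.Reachable.symm (show (HH G φ hs α β).Reachable b a from h)

/-- neighbours of the root which are reached by colours seen / missing at `x` -/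
theorem cost_sets (hc : Ctx G x D Low) {w : V} {φ : V → V → ℕ} (h : Col G x D w φ) :
    ∃ A : Finset V, ∑ z ∈ A, (D - G.degree z) + 1 ≤ G.degree x ∧
      (((G.neighborFinset w).erase x) \ A).card + 2 ≤ G.degree x := by
  obtain ⟨γ, hγ⟩ := root_miss hc h
  set A := ((G.neighborFinset w).erase x).filter fun z => Miss G D φ x (φ w z) with hA
  have hAm : ∀ z, z ∈ A ↔ z ≠ x ∧ G.Adj w z ∧ Miss G D φ x (φ w z) := by
    intro z; simp [hA, and_assoc]
  set S := ((G.neighborFinset x).erase w).image (φ x) with hS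
  have hScard : S.card + 1 ≤ G.degree x := by
    have h1 : S.card ≤ _ := Finset.card_image_le
    have h2 : w ∈ G.neighborFinset x := by simpa using h.adj
    rw [Finset.card_erase_of_mem h2, SimpleGraph.card_neighborFinset_eq_degree] at h1
    have : 0 < G.degree x := by
      rw [← SimpleGraph.card_neighborFinset_eq_degree]
      exact Finset.card_pos.2 ⟨w, h2⟩
    omega
  have hSm : ∀ c, 1 ≤ c → c ≤ D → ¬ Miss G D φ x c → c ∈ S := by
    intro c h1 h2 hn
    unfold Miss at hn
    push Not at hn
    obtain ⟨b, hb, rfl⟩ := hn h1 h2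
    refine Finset.mem_image.2 ⟨b, Finset.mem_erase.2 ⟨?_, by simpa using hb⟩, rfl⟩
    rintro rfl
    have := h.xv
    omega
  refine ⟨A, ?_, ?_⟩
  · set ms : V → Finset ℕ := fun u => (Finset.Icc 1 D) \ (G.neighborFinset u).image (φ u) with hms
    have hmsm : ∀ u c, c ∈ ms u → Miss G D φ u c := by
      intro u c hcm
      simp only [hms, Finset.mem_sdiff, Finset.mem_Icc, Finset.mem_image,
        SimpleGraph.mem_neighborFinset, not_exists, not_and] at hcm
      exact ⟨hcm.1.1, hcm.1.2, fun b hb => hcm.2 b hb⟩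
    have hmsc : ∀ u, D - G.degree u ≤ (ms u).card := by
      intro u
      have h1 := Finset.le_card_sdiff ((G.neighborFinset u).image (φ u)) (Finset.Icc 1 D)
      have h2 : ((G.neighborFinset u).image (φ u)).card ≤ G.degree u := Finset.card_image_le
      rw [Nat.card_Icc] at h1
      simp only [hms]
      omega
    have hdis : ∀ u ∈ A, ∀ u' ∈ A, u ≠ u' → Disjoint (ms u) (ms u') := by
      intro u hu u' hu' hne
      rw [Finset.disjoint_left]
      intro c h1 h2
      obtain ⟨a1, a2, a3⟩ := (hAm u).1 hu
      obtain ⟨b1, b2, b3⟩ := (hAm u').1 hu'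
      have k1 := KK_comm (F0 hc h a2 a1 a3 hγ (hmsm _ _ h1))
      have k2 := KK_comm (F0 hc h b2 b1 b3 hγ (hmsm _ _ h2))
      exact three_ends h.sym h.proper a2.ne b2.ne hne (miss_end (D := D) (Or.inl hγ))
        (miss_end (Or.inr (hmsm _ _ h1))) (miss_end (Or.inr (hmsm _ _ h2))) k1 k2
    have hsub : A.biUnion ms ⊆ S := by
      intro c hcm
      obtain ⟨u, hu, hcu⟩ := Finset.mem_biUnion.1 hcm
      obtain ⟨a1, a2, a3⟩ := (hAm u).1 hu
      have hm := hmsm _ _ hcu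
      refine hSm c hm.1 hm.2.1 fun hx => ?_
      exact (far hc h hγ hx a1 a2.ne' (Or.inr hm)).2 (F0 hc h a2 a1 a3 hγ hm)
    have hcard := Finset.card_le_card hsub
    rw [Finset.card_biUnion hdis] at hcard
    have := Finset.sum_le_sum (fun u (_ : u ∈ A) => hmsc u)
    omega
  · have hγS : γ ∈ S := hSm γ hγ.1 hγ.2.1 fun hx => no_common hc h hγ hx
    have hsub : (((G.neighborFinset w).erase x) \ A).image (φ w) ⊆ S.erase γ := by
      intro c hcm
      obtain ⟨z, hz, rfl⟩ := Finset.mem_image.1 hcm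
      rw [Finset.mem_sdiff, hAm, Finset.mem_erase, SimpleGraph.mem_neighborFinset] at hz
      have hwz := hz.1.2
      refine Finset.mem_erase.2 ⟨hγ.2.2 z hwz, hSm _ ?_ (h.le _ _ hwz) fun hh => hz.2 ⟨hz.1.1, hwz, hh⟩⟩
      by_contra h0
      have h0 : φ w z = 0 := by omega
      rw [h.zero w z hwz] at h0
      rcases h0 with ⟨e, -⟩ | ⟨-, e⟩
      · exact h.adj.ne e.symm
      · exact hz.1.1 e
    have hinj : Set.InjOn (φ w) ((((G.neighborFinset w).erase x) \ A : Finset V)) := by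
      intro a ha b hb hab
      simp only [Finset.coe_sdiff, Finset.coe_erase, Set.mem_sdiff, Finset.mem_coe,
        SimpleGraph.mem_neighborFinset] at ha hb
      exact h.proper w a b ha.1.1 hb.1.1 hab
    have hcard := Finset.card_le_card hsub
    rw [Finset.card_image_of_injOn hinj, Finset.card_erase_of_mem hγS] at hcard
    have : 0 < S.card := Finset.card_pos.2 ⟨γ, hγS⟩
    omega

theorem sigma_bound (N : Finset V) (s : V → ℕ) (hN : 3 ≤ N.card)
    (hfan : ∀ w ∈ N, ∃ R : Finset V, w ∈ R ∧ R ⊆ N ∧ ∑ u ∈ R, s u + 2 ≤ R.card) :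
    (5 / 2 : ℝ) ≤ ∑ y ∈ N, 1 / (1 + (s y : ℝ)) ∧
    (4 ≤ N.card → (3 : ℝ) ≤ ∑ y ∈ N, 1 / (1 + (s y : ℝ))) ∧
    (5 ≤ N.card → (10 / 3 : ℝ) ≤ ∑ y ∈ N, 1 / (1 + (s y : ℝ))) := by
  obtain ⟨w, hw, hmax⟩ := Finset.exists_max_image N s (Finset.card_pos.1 (by omega))
  obtain ⟨R, hwR, hRN, hR⟩ := hfan w hw
  have hsw : s w ≤ ∑ u ∈ R, s u := Finset.single_le_sum (fun _ _ => Nat.zero_le _) hwR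
  have hcard := Finset.card_le_card hRN
  have hsd : (N \ R).card = N.card - R.card := Finset.card_sdiff_of_subset hRN
  have hRr : ((∑ u ∈ R, s u : ℕ) : ℝ) + 2 ≤ R.card := by exact_mod_cast hR
  push_cast at hRr
  have hin : 1 + (R.card : ℝ) / 2 ≤ ∑ y ∈ R, 1 / (1 + (s y : ℝ)) := by
    have h1 : ∑ y ∈ R, (1 - (s y : ℝ) / 2) ≤ ∑ y ∈ R, 1 / (1 + (s y : ℝ)) := by
      refine Finset.sum_le_sum fun y _ => ?_
      rw [le_div_iff₀ (by positivity)]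
      have : (s y : ℝ) ≤ (s y : ℝ) ^ 2 := by
        exact_mod_cast Nat.le_self_pow (by norm_num) (s y)
      nlinarith
    rw [Finset.sum_sub_distrib, ← Finset.sum_div] at h1
    simp only [Finset.sum_const, nsmul_eq_mul, mul_one] at h1
    linarith
  have hr1 : (1 : ℝ) ≤ (R.card : ℝ) - 1 := by
    have : (2 : ℝ) ≤ R.card := by exact_mod_cast (show 2 ≤ R.card by omega)
    linarith
  have hout : ((N.card : ℝ) - R.card) / ((R.card : ℝ) - 1) ≤ ∑ y ∈ N \ R, 1 / (1 + (s y : ℝ)) := by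
    have h1 : ∑ y ∈ N \ R, 1 / ((R.card : ℝ) - 1) ≤ ∑ y ∈ N \ R, 1 / (1 + (s y : ℝ)) := by
      refine Finset.sum_le_sum fun y hy => ?_
      apply one_div_le_one_div_of_le (by positivity)
      have h2 := hmax y (Finset.mem_sdiff.1 hy).1
      have : ((s y + 2 : ℕ) : ℝ) ≤ R.card := by exact_mod_cast (show s y + 2 ≤ R.card by omega)
      push_cast at this
      linarith
    rw [Finset.sum_const, hsd, nsmul_eq_mul, Nat.cast_sub hcard] at h1
    rwa [mul_one_div] at h1
  have hsum := Finset.sum_sdiff hRN (f := fun y => 1 / (1 + (s y : ℝ)))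
  rw [← hsum]
  have hNr : (3 : ℝ) ≤ N.card := by exact_mod_cast hN
  have h0 : (0 : ℝ) ≤ ∑ y ∈ N \ R, 1 / (1 + (s y : ℝ)) := Finset.sum_nonneg fun y _ => by positivity
  have h4 : 4 ≤ N.card → (4 : ℝ) ≤ N.card := fun h => by exact_mod_cast h
  have h5 : 5 ≤ N.card → (5 : ℝ) ≤ N.card := fun h => by exact_mod_cast h
  clear hsum
  generalize ∑ y ∈ N \ R, 1 / (1 + (s y : ℝ)) = S1 at *
  generalize ∑ y ∈ R, 1 / (1 + (s y : ℝ)) = S2 at *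
  rcases Nat.lt_or_ge R.card 5 with hr | hr
  · have hr2 : 2 ≤ R.card := by omega
    have hk : (R.card : ℝ) ≤ N.card := by exact_mod_cast hcard
    interval_cases hrr : R.card
    all_goals
      norm_num at hin hout hk
      refine ⟨by linarith, fun h => ?_, fun h => ?_⟩
      · have := h4 h
        linarith
      · have := h5 h
        linarith
  · have : (5 : ℝ) ≤ R.card := by exact_mod_cast hr
    exact ⟨by linarith, fun _ => by linarith, fun _ => by linarith⟩

theorem crit_no (hG : IsDeltaCritical G) (φ : V → V → ℕ) : ¬ IsEdgeColoring G G.maxDegree φ := by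
  intro h
  have h1 : chromIndex G ≤ G.maxDegree := Nat.sInf_le ⟨φ, h⟩
  have := hG.2.1
  omega

theorem crit_col (hG : IsDeltaCritical G) (h0 : 0 < G.maxDegree) {x y : V} (hxy : G.Adj x y) :
    ∃ φ, Col G x G.maxDegree y φ := by
  have h1 := hG.2.2 s(x, y) hxy
  have hne : {k | ∃ φ : V → V → ℕ, IsEdgeColoring (G.deleteEdges {s(x, y)}) k φ}.Nonempty := by
    apply Nat.nonempty_of_pos_sInf
    unfold chromIndex at h1
    omega
  have h2 := Nat.sInf_mem hne
  unfold chromIndex at h1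
  rw [h1] at h2
  obtain ⟨ψ, a1, a2, a3⟩ := h2
  have hadj : ∀ a b, G.Adj a b → ¬ ((a = x ∧ b = y) ∨ (a = y ∧ b = x)) →
      (G.deleteEdges {s(x, y)}).Adj a b := by
    intro a b hab hn
    rw [SimpleGraph.deleteEdges_adj]
    refine ⟨hab, ?_⟩
    rw [Set.mem_singleton_iff, Sym2.eq_iff]
    exact hn
  refine ⟨fun a b => if (a = x ∧ b = y) ∨ (a = y ∧ b = x) then 0 else ψ a b, hxy, ?_, ?_, ?_, ?_⟩
  · intro a b
    simp only [a1 a b]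
    congr 1
    exact propext (by tauto)
  · intro a b hab
    split_ifs with hh
    · exact Nat.zero_le _
    · exact (Finset.mem_Icc.1 (a2 (hadj a b hab hh))).2
  · intro p a b ha hb
    have hp : x ≠ y := hxy.ne
    split_ifs with k1 k2 k2
    · intro _
      rcases k1 with ⟨rfl, rfl⟩ | ⟨rfl, rfl⟩ <;> rcases k2 with ⟨k3, k4⟩ | ⟨k3, k4⟩ <;> simp_all
    · intro hh
      have := (Finset.mem_Icc.1 (a2 (hadj p b hb k2))).1
      omega
    · intro hh
      have := (Finset.mem_Icc.1 (a2 (hadj p a ha k1))).1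
      omega
    · intro hh
      by_contra hab
      exact a3 (hadj p a ha k1) (hadj p b hb k2) hab hh
  · intro a b hab
    split_ifs with hh
    · simp [hh]
    · have := (Finset.mem_Icc.1 (a2 (hadj a b hab hh))).1
      simp only [hh, iff_false]
      omega

theorem core (G : SimpleGraph V) [DecidableRel G.Adj]
    (d : ℕ) (hd : d = 3 ∨ d = 4)
    (hG : IsDeltaCritical G)
    (hmax : 1000 ≤ G.maxDegree)
    (X : Finset V) (hXind : ∀ u ∈ X, ∀ v ∈ X, u ≠ v → ¬ G.Adj u v)
    (q : ℝ) (hq : q = ((d : ℝ) / ((d : ℝ) + 2)) * G.maxDegree)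
    (x : V) (hx : x ∈ X)
    (hdeg : d ≤ G.degree x ∧ G.degree x < 3 * (d - 1)) :
    ((d : ℝ) + 2) * G.maxDegree ≤ M2starX G d 2 q X x := by
  set Δ := G.maxDegree with hΔ
  set k := G.degree x with hk
  have hΔr : (1000 : ℝ) ≤ Δ := by exact_mod_cast hmax
  have hk8 : k ≤ 8 := by omega
  have hk8r : (k : ℝ) ≤ 8 := by exact_mod_cast hk8
  have hd3 : (3 : ℝ) ≤ d := by rcases hd with rfl | rfl <;> norm_num
  have hd4 : (d : ℝ) ≤ 4 := by rcases hd with rfl | rfl <;> norm_num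
  have hdk : (d : ℝ) ≤ k := by exact_mod_cast hdeg.1
  have hq1 : (3 / 5 : ℝ) * Δ ≤ q := by rcases hd with rfl | rfl <;> norm_num [hq] <;> linarith
  have hq2 : q ≤ (2 / 3 : ℝ) * Δ := by rcases hd with rfl | rfl <;> norm_num [hq] <;> linarith
  have hq0 : 0 < q := by linarith
  have hxm : x ∈ Xm G d q X := by
    refine Finset.mem_filter.2 ⟨hx, hdeg.1, ?_⟩
    rw [← hk]
    linarith
  have hxp : x ∉ Xp G q X := by
    intro hh
    have := (Finset.mem_filter.1 hh).2.1
    rw [← hk] at this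
    linarith
  set Low : V → Prop := fun z => z ∈ Xm G d q X ∧ z ≠ x with hLow
  have hc : Ctx G x Δ Low := by
    refine ⟨crit_no hG, fun v => G.degree_le_maxDegree v, ?_, ?_⟩
    · intro z hz
      exact ⟨hXind x hx z (Finset.mem_filter.1 hz.1).1 hz.2.symm, hz.2⟩
    · intro z hz
      have h1 := (Finset.mem_filter.1 hz.1).2.2
      have : ((G.degree z + G.degree x + 2 : ℕ) : ℝ) ≤ Δ := by
        push_cast
        rw [← hk]
        linarith
      exact_mod_cast this
  set s : V → ℕ := fun u => ((G.neighborFinset u).filter Low).card with hs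
  have hcardN : (G.neighborFinset x).card = k := G.card_neighborFinset_eq_degree x
  have hσ := sigma_bound (G.neighborFinset x) s (by omega) (by
    intro w hw
    obtain ⟨φ, hφ⟩ := crit_col hG (by omega) (show G.Adj x w by simpa using hw)
    convert fan hc hφ)
  rw [hcardN] at hσ
  set σ := ∑ y ∈ G.neighborFinset x, 1 / (1 + (s y : ℝ)) with hσd
  set κ : ℝ := ((d : ℝ) + 2) / q with hκ
  have hκ0 : 0 ≤ κ := by positivity
  have hκ1 : κ ≤ 1 / 100 := by
    rw [hκ, div_le_iff₀ hq0]
    linarith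
  have hκq : κ * (Δ - q) = 2 * ((d : ℝ) + 2) / d := by
    rw [hκ, hq]
    field_simp
    ring
  set C : ℝ := ((k : ℝ) - 2) * (2 * ((d : ℝ) + 2) / d) + ((k : ℝ) - 1) * κ with hC
  have hg : ∀ z ∈ Xp G q X, g1 d Δ (G.degree z) ≤ κ * (Δ - G.degree z) ∧
      g1 d Δ (G.degree z) ≤ 2 * ((d : ℝ) + 2) / d := by
    intro z hz
    obtain ⟨-, h1, h2⟩ := Finset.mem_filter.1 hz
    have h2r : (G.degree z : ℝ) ≤ Δ := by exact_mod_cast h2.le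
    have h3 : g1 d Δ (G.degree z) ≤ κ * (Δ - G.degree z) := by
      unfold g1
      rw [hκ, div_mul_eq_mul_div]
      apply div_le_div_of_nonneg_left _ hq0 h1
      exact mul_nonneg (by positivity) (by linarith)
    refine ⟨h3, h3.trans ?_⟩
    rw [← hκq]
    exact mul_le_mul_of_nonneg_left (by linarith) hκ0
  have hstar : ∀ y ∈ G.neighborFinset x, 2 * Δ - C ≤ M1star G d 2 q X y := by
    intro y hy
    obtain ⟨φ, hφ⟩ := crit_col hG (by omega) (show G.Adj x y by simpa using hy)
    obtain ⟨A, hA1, hA2⟩ := cost_sets hc hφ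
    unfold M1star
    have : ∑ z ∈ G.neighborFinset y ∩ Xp G q X, g1 d (G.maxDegree : ℝ) (G.degree z : ℝ) ≤ C := by
      set S := G.neighborFinset y ∩ Xp G q X with hS
      have hSp : ∀ z ∈ S, z ∈ Xp G q X := fun z hz => (Finset.mem_inter.1 hz).2
      rw [← Finset.sum_inter_add_sum_sdiff S A]
      have e1 : ∑ z ∈ S ∩ A, g1 d (G.maxDegree : ℝ) (G.degree z : ℝ) ≤ ((k : ℝ) - 1) * κ := by
        have f1 : ∑ z ∈ S ∩ A, g1 d (G.maxDegree : ℝ) (G.degree z : ℝ) ≤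
            ∑ z ∈ S ∩ A, κ * ((Δ - G.degree z : ℕ) : ℝ) := by
          refine Finset.sum_le_sum fun z hz => ?_
          rw [Nat.cast_sub (G.degree_le_maxDegree z)]
          exact (hg z (hSp z (Finset.mem_inter.1 hz).1)).1
        have f2 : ∑ z ∈ S ∩ A, κ * ((Δ - G.degree z : ℕ) : ℝ) ≤ ∑ z ∈ A, κ * ((Δ - G.degree z : ℕ) : ℝ) :=
          Finset.sum_le_sum_of_subset_of_nonneg Finset.inter_subset_right
            (fun z _ _ => mul_nonneg hκ0 (Nat.cast_nonneg _))
        rw [← Finset.mul_sum, ← Finset.mul_sum] at f2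
        rw [← Finset.mul_sum] at f1
        have f3 : ((∑ z ∈ A, (Δ - G.degree z) + 1 : ℕ) : ℝ) ≤ k := by exact_mod_cast hA1
        rw [Nat.cast_add, Nat.cast_sum, Nat.cast_one] at f3
        have f4 : κ * ∑ z ∈ A, ((Δ - G.degree z : ℕ) : ℝ) ≤ κ * ((k : ℝ) - 1) :=
          mul_le_mul_of_nonneg_left (by linarith) hκ0
        linarith
      have e2 : ∑ z ∈ S \ A, g1 d (G.maxDegree : ℝ) (G.degree z : ℝ) ≤
          ((k : ℝ) - 2) * (2 * ((d : ℝ) + 2) / d) := by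
        have f1 : ∑ z ∈ S \ A, g1 d (G.maxDegree : ℝ) (G.degree z : ℝ) ≤
            ∑ z ∈ S \ A, 2 * ((d : ℝ) + 2) / d :=
          Finset.sum_le_sum fun z hz => (hg z (hSp z (Finset.mem_sdiff.1 hz).1)).2
        rw [Finset.sum_const, nsmul_eq_mul] at f1
        have f2 : (S \ A).card ≤ (((G.neighborFinset y).erase x) \ A).card := by
          refine Finset.card_le_card fun z hz => ?_
          obtain ⟨z1, z2⟩ := Finset.mem_sdiff.1 hz
          refine Finset.mem_sdiff.2 ⟨Finset.mem_erase.2 ⟨?_, (Finset.mem_inter.1 z1).1⟩, z2⟩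
          rintro rfl
          exact hxp (hSp z z1)
        have f3 : (((S \ A).card + 2 : ℕ) : ℝ) ≤ k := by exact_mod_cast (show (S \ A).card + 2 ≤ k by omega)
        push_cast at f3
        have : ((S \ A).card : ℝ) * (2 * ((d : ℝ) + 2) / d) ≤ ((k : ℝ) - 2) * (2 * ((d : ℝ) + 2) / d) :=
          mul_le_mul_of_nonneg_right (by linarith) (by positivity)
        linarith
      linarith
    linarith
  have hfrac : 2 * ((d : ℝ) + 2) / d ≤ 10 / 3 := by
    rcases hd with rfl | rfl <;> norm_num
  have hC1 : C ≤ 30 := by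
    have h1 : ((k : ℝ) - 2) * (2 * ((d : ℝ) + 2) / d) ≤ 6 * (10 / 3) :=
      mul_le_mul (by linarith) hfrac (by positivity) (by norm_num)
    have h2 : ((k : ℝ) - 1) * κ ≤ 7 * (1 / 100) := mul_le_mul (by linarith) hκ1 hκ0 (by norm_num)
    linarith
  have hstep : ∀ y ∈ G.neighborFinset x, (2 * Δ - C) * (1 / (1 + (s y : ℝ))) ≤ step2 G d 2 q X y := by
    intro y hy
    have hM := hstar y hy
    have hxy : G.Adj x y := by simpa using hy
    have hset : G.neighborFinset y ∩ Xm G d q X = insert x ((G.neighborFinset y).filter Low) := by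
      ext z
      simp only [Finset.mem_inter, Finset.mem_insert, Finset.mem_filter, hLow,
        SimpleGraph.mem_neighborFinset]
      constructor
      · rintro ⟨h1, h2⟩
        by_cases hzx : z = x
        · exact Or.inl hzx
        · exact Or.inr ⟨h1, h2, hzx⟩
      · rintro (rfl | ⟨h1, h2, -⟩)
        · exact ⟨hxy.symm, hxm⟩
        · exact ⟨h1, h2⟩
    have hcd : ((G.neighborFinset y ∩ Xm G d q X).card : ℝ) = 1 + s y := by
      rw [hset, Finset.card_insert_of_notMem (by simp [hLow])]
      push_cast
      rw [hs]
      ring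
    unfold step2
    rw [if_pos ⟨by linarith, ⟨x, by rw [hset]; simp⟩⟩, hcd, mul_one_div]
    exact div_le_div_of_nonneg_right hM (by positivity)
  unfold M2starX
  rw [if_neg hxp, if_pos hxm]
  have hfil : (G.neighborFinset x).filter (· ∉ X) = G.neighborFinset x := by
    refine Finset.filter_true_of_mem fun y hy hyX => ?_
    have hxy : G.Adj x y := by simpa using hy
    exact hXind x hx y hyX hxy.ne hxy
  rw [hfil]
  have hsum := Finset.sum_le_sum hstep
  rw [← Finset.mul_sum, ← hσd] at hsum
  have key : ((d : ℝ) + 2) * Δ ≤ ((d : ℝ) + 2) * k + (2 * Δ - C) * σ := by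
    have hpos : 0 ≤ 2 * (Δ : ℝ) - C := by linarith
    rcases Nat.lt_or_ge k 4 with h4 | h4
    · have hk3 : k = 3 := by omega
      have hd3 : d = 3 := by omega
      have := mul_le_mul_of_nonneg_left hσ.1 hpos
      rw [hk3, hd3] at hC ⊢
      norm_num at hC ⊢
      linarith
    rcases Nat.lt_or_ge k 5 with h5 | h5
    · have hk4 : k = 4 := by omega
      have := mul_le_mul_of_nonneg_left (hσ.2.1 h4) hpos
      rcases hd with hd | hd
      · rw [hk4, hd]
        norm_num
        linarith
      · rw [hk4, hd] at hC ⊢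
        norm_num at hC ⊢
        linarith
    · have := mul_le_mul_of_nonneg_left (hσ.2.2 h5) hpos
      have : (5 : ℝ) ≤ k := by exact_mod_cast h5
      rcases hd with hd | hd
      · rw [hd]
        norm_num
        linarith
      · rw [hd]
        norm_num
        linarith
  linarith

end Kempe

/-- Discharging setup as in the paper, with `d ∈ {3,4}` and `ω = 2`. For each
`x ∈ X₃⁻ = {x ∈ X : d ≤ d(x) < 3(d-1)}` one has `M₂*(x) ≥ (d+2)Δ = M₂(x)`. -/
theorem statement19 (G : SimpleGraph V) [DecidableRel G.Adj]
    (d : ℕ) (hd : d = 3 ∨ d = 4)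
    (hG : IsDeltaCritical G) (hmin : ∀ v : V, d ≤ G.degree v)
    (hmax : (d + 2) ^ (5 * d + 10) ≤ G.maxDegree)
    (X : Finset V) (hXind : ∀ u ∈ X, ∀ v ∈ X, u ≠ v → ¬ G.Adj u v)
    (hXmax : ∀ s : Finset V, (∀ u ∈ s, ∀ v ∈ s, u ≠ v → ¬ G.Adj u v) → s.card ≤ X.card)
    (ω : ℝ) (hω : ω = 2)
    (q : ℝ) (hq : q = (((d : ℝ) + 2 - ω) / ((d : ℝ) + 2)) * G.maxDegree)
    (x : V) (hx : x ∈ X)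
    (hdeg : d ≤ G.degree x ∧ G.degree x < 3 * (d - 1)) :
    ((d : ℝ) + 2) * G.maxDegree ≤ M2starX G d ω q X x := by
  subst hω
  refine core G d hd hG ?_ X hXind q ?_ x hx hdeg
  · rcases hd with rfl | rfl
    · exact le_trans (by norm_num) hmax
    · exact le_trans (by norm_num) hmax
  · rw [hq]
    congr 2
    ring
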